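/- Let E = (E^0, E^1, r, s) be a topological graph. Fix an open set U ⊆ E^* and a compact set K ⊆ E^* with Z(U) ∩ Z(K)^c ≠ ∅, and write K ⊆ ⋃_{i=0}^{k} E^i for some k ≥ 0 (possible since K is compact in the disjoint union E^*). Then for every boundary path μ ∈ Z(U) ∩ Z(K)^c with |μ| ≥ k there exists an open subset V of E^* such that μ ∈ Z(V) ⊆ Z(U) ∩ Z(K)^c. -/

import Mathlib

/-- A locally compact Hausdorff space is *totally disconnected* (in the sense used for
topological graphs) if it has an open base consisting of compact open subsets. -/
def TotallyDisc (T : Type) [TopologicalSpace T] : Prop :=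
  ∀ (t : T) (U : Set T), IsOpen U → t ∈ U →
    ∃ W : Set T, IsCompact W ∧ IsOpen W ∧ t ∈ W ∧ W ⊆ U

/-- A topological graph `E = (E⁰, E¹, r, s)`: `r` continuous, `s` a local homeomorphism. -/
structure TopGraph (V E : Type) [TopologicalSpace V] [TopologicalSpace E] where
  r : E → V
  s : E → V
  cont_r : Continuous r
  locHomeo_s : IsLocalHomeomorph s

namespace TopGraph

variable {V E : Type} [TopologicalSpace V] [TopologicalSpace E] (G : TopGraph V E)

/-- Compatibility condition for a finite sequence of edges to be a path. -/
def PathCond (n : ℕ) (μ : Fin n → E) : Prop :=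
  ∀ (i : ℕ) (h : i + 1 < n), G.s (μ ⟨i, Nat.lt_of_succ_lt h⟩) = G.r (μ ⟨i + 1, h⟩)

/-- The space `Eⁿ` of paths of length `n`; paths of length `0` are vertices. -/
def PathN : ℕ → Type
  | 0 => V
  | n + 1 => { μ : Fin (n + 1) → E // G.PathCond (n + 1) μ }

instance pathNTop : (n : ℕ) → TopologicalSpace (G.PathN n)
  | 0 => inferInstanceAs (TopologicalSpace V)
  | n + 1 => inferInstanceAs (TopologicalSpace { μ : Fin (n + 1) → E // G.PathCond (n + 1) μ })

/-- The finite path space `E* = ⨿ₙ Eⁿ` with the disjoint union topology. -/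
def FinPath : Type := (n : ℕ) × G.PathN n

instance : TopologicalSpace G.FinPath := inferInstanceAs (TopologicalSpace ((n : ℕ) × G.PathN n))

/-- The range `r(μ)` of a finite path. -/
def pathRange : (n : ℕ) → G.PathN n → V
  | 0, v => v
  | _ + 1, μ => G.r (μ.1 ⟨0, Nat.succ_pos _⟩)

/-- The source `s(μ)` of a finite path. -/
def pathSource : (n : ℕ) → G.PathN n → V
  | 0, v => v
  | n + 1, μ => G.s (μ.1 ⟨n, Nat.lt_succ_self n⟩)

/-- The `i`-th edge of a finite path (`none` if out of range); `0`-indexed. -/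
def pathEdge : (n : ℕ) → G.PathN n → ℕ → Option E
  | 0, _, _ => none
  | n + 1, μ, i => if h : i < n + 1 then some (μ.1 ⟨i, h⟩) else none

/-- `E⁰_sce = E⁰ \ cl (r(E¹))`. -/
def sce : Set V := {v | v ∉ closure (Set.range G.r)}

/-- `E⁰_fin`: vertices with an open neighborhood `N` such that `r⁻¹(cl N)` is compact. -/
def finV : Set V := {v | ∃ N : Set V, IsOpen N ∧ v ∈ N ∧ IsCompact (G.r ⁻¹' closure N)}

/-- `E⁰_rg = E⁰_fin \ cl (E⁰_sce)`. -/
def rg : Set V := G.finV \ closure G.sce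

/-- `E⁰_sg = E⁰ \ E⁰_rg`. -/
def sg : Set V := {v | v ∉ G.rg}

/-- The infinite path space `E^∞`. -/
def InfPath : Type := { μ : ℕ → E // ∀ i : ℕ, G.s (μ i) = G.r (μ (i + 1)) }

/-- The boundary path space `∂E = E^∞ ⨿ {μ ∈ E* : s(μ) ∈ E⁰_sg}`. -/
def BoundaryPath : Type :=
  G.InfPath ⊕ { α : G.FinPath // G.pathSource α.1 α.2 ∈ G.sg }

/-- The finite boundary path determined by a finite path whose source is singular. -/
def mkFin (α : G.FinPath) (h : G.pathSource α.1 α.2 ∈ G.sg) : G.BoundaryPath :=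
  Sum.inr ⟨α, h⟩

/-- The length of a boundary path, in `ℕ∞`. -/
def bLen : G.BoundaryPath → ℕ∞
  | Sum.inl _ => ⊤
  | Sum.inr α => (α.1.1 : ℕ∞)

/-- The `i`-th edge of a boundary path. -/
def bEdge : G.BoundaryPath → ℕ → Option E
  | Sum.inl μ, i => some (μ.1 i)
  | Sum.inr α, i => G.pathEdge α.1.1 α.1.2 i

/-- The range vertex of a boundary path. -/
def bRange : G.BoundaryPath → V
  | Sum.inl μ => G.r (μ.1 0)
  | Sum.inr α => G.pathRange α.1.1 α.1.2

/-- `α ∈ E*` is an initial segment of the boundary path `μ`, i.e. `μ = αβ`. -/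
def IsPrefix (α : G.FinPath) (μ : G.BoundaryPath) : Prop :=
  G.pathRange α.1 α.2 = G.bRange μ ∧
    ∀ i : ℕ, i < α.1 → G.bEdge μ i = G.pathEdge α.1 α.2 i

/-- The cylinder set `Z(S) ⊆ ∂E` of a set `S ⊆ E*`. -/
def cyl (S : Set G.FinPath) : Set G.BoundaryPath :=
  {μ | ∃ α ∈ S, G.IsPrefix α μ}

/-- The topology on `∂E`, generated by the sets `Z(U) ∩ Z(K)ᶜ` with `U` open, `K` compact. -/
instance : TopologicalSpace G.BoundaryPath :=
  TopologicalSpace.generateFrom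
    {W | ∃ (U K : Set G.FinPath), IsOpen U ∧ IsCompact K ∧ W = G.cyl U ∩ (G.cyl K)ᶜ}

/-- Removing the first edge of a path of length `n + 1`. -/
def pathTail : (n : ℕ) → G.PathN (n + 1) → G.PathN n
  | 0, μ => G.s (μ.1 ⟨0, Nat.one_pos⟩)
  | n + 1, μ => ⟨fun i => μ.1 ⟨i.1 + 1, by omega⟩, fun i h => μ.2 (i + 1) (by omega)⟩

theorem pathSource_pathTail : ∀ (n : ℕ) (μ : G.PathN (n + 1)),
    G.pathSource n (G.pathTail n μ) = G.pathSource (n + 1) μ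
  | 0, μ => rfl
  | n + 1, μ => rfl

/-- The one-sided shift `σ` on `∂E` (the identity on paths of length `0`,
where it is undefined). -/
def shift : G.BoundaryPath → G.BoundaryPath
  | Sum.inl μ => Sum.inl ⟨fun i => μ.1 (i + 1), fun i => μ.2 (i + 1)⟩
  | Sum.inr α =>
    match α with
    | ⟨⟨0, v⟩, h⟩ => Sum.inr ⟨⟨0, v⟩, h⟩
    | ⟨⟨n + 1, μ⟩, h⟩ =>
        Sum.inr ⟨⟨n, G.pathTail n μ⟩, by rw [G.pathSource_pathTail]; exact h⟩

/-- The Renault–Deaconu relation of the boundary path groupoid `Γ(∂E, σ)`: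
`(μ, n, ν)` is an element of the groupoid. -/
def bRD (μ : G.BoundaryPath) (n : ℤ) (ν : G.BoundaryPath) : Prop :=
  ∃ k l : ℕ, n = (k : ℤ) - (l : ℤ) ∧ (k : ℕ∞) ≤ G.bLen μ ∧ (l : ℕ∞) ≤ G.bLen ν ∧
    G.shift^[k] μ = G.shift^[l] ν

/-- The boundary path groupoid `Γ(∂E, σ)` as a set of triples. -/
def BPGroupoid : Type :=
  { x : G.BoundaryPath × ℤ × G.BoundaryPath // G.bRD x.1 x.2.1 x.2.2 }

/-- The range map of the boundary path groupoid. -/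
def gR (x : G.BPGroupoid) : G.BoundaryPath := x.1.1

/-- The source map of the boundary path groupoid. -/
def gS (x : G.BPGroupoid) : G.BoundaryPath := x.1.2.2

/-- The topology on `Γ(∂E, σ)` generated by the basic open sets `𝒰(U, V, k, l)`. -/
instance : TopologicalSpace G.BPGroupoid :=
  TopologicalSpace.generateFrom
    {W | ∃ (U Vs : Set G.BoundaryPath) (k l : ℕ),
      IsOpen U ∧ IsOpen Vs ∧
      (∀ μ ∈ U, (k : ℕ∞) ≤ G.bLen μ) ∧ (∀ μ ∈ Vs, (l : ℕ∞) ≤ G.bLen μ) ∧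
      Set.InjOn (G.shift^[k]) U ∧ Set.InjOn (G.shift^[l]) Vs ∧
      W = {x : G.BPGroupoid | G.gR x ∈ U ∧ G.gS x ∈ Vs ∧ x.1.2.1 = (k : ℤ) - (l : ℤ) ∧
        G.shift^[k] (G.gR x) = G.shift^[l] (G.gS x)}}

/-- A unit `μ ∈ ∂E` has trivial isotropy in `Γ(∂E, σ)`. -/
def TrivialIsotropy (μ : G.BoundaryPath) : Prop :=
  ∀ n : ℤ, G.bRD μ n μ → n = 0

/-- `E` is essentially free: the units with trivial isotropy are dense in `∂E`. -/
def EssentiallyFree : Prop := Dense {μ : G.BoundaryPath | G.TrivialIsotropy μ}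

/-- `N ⊆ Γ(∂E, σ)` is a bisection: the source and range maps restrict to homeomorphisms
of `N` onto their images. -/
def IsBisection (N : Set G.BPGroupoid) : Prop :=
  Topology.IsEmbedding (N.restrict G.gS) ∧ Topology.IsEmbedding (N.restrict G.gR)

/-- The boundary path groupoid `Γ(∂E, σ)` is locally contracting
(Anantharaman-Delaroche): for every nonempty open `U` in the unit space `∂E` there are an
open `V ⊆ U` and an open bisection `N` with `cl V ⊆ s(N)` and
`s((r|_{N⁻¹})⁻¹(cl V)) ⊊ V`. -/
def BPLocallyContracting : Prop :=
  ∀ U : Set G.BoundaryPath, IsOpen U → U.Nonempty →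
    ∃ (Vs : Set G.BoundaryPath) (N : Set G.BPGroupoid),
      IsOpen Vs ∧ Vs ⊆ U ∧ IsOpen N ∧ G.IsBisection N ∧
      closure Vs ⊆ G.gS '' N ∧
      G.gR '' (N ∩ {x | G.gS x ∈ closure Vs}) ⊂ Vs

/-- `μ` is a cycle: a path of length `n + 1 ≥ 1` with `r(μ) = s(μ)`. -/
def IsCycle (n : ℕ) (μ : G.PathN (n + 1)) : Prop :=
  G.pathRange (n + 1) μ = G.pathSource (n + 1) μ

/-- The cycle `μ` has no entrances: `r⁻¹(r(μᵢ)) = {μᵢ}` for all `i`. -/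
def NoEntrances (n : ℕ) (μ : G.PathN (n + 1)) : Prop :=
  ∀ (i : Fin (n + 1)) (e : E), G.r e = G.r (μ.1 i) → e = μ.1 i

/-- The cycle `μ` has entrances. -/
def HasEntrances (n : ℕ) (μ : G.PathN (n + 1)) : Prop := ¬ G.NoEntrances n μ

/-- `E` is topologically free: the set of base points of cycles without entrances has
empty interior. -/
def TopologicallyFree : Prop :=
  interior {v : V | ∃ (n : ℕ) (μ : G.PathN (n + 1)),
    G.IsCycle n μ ∧ G.NoEntrances n μ ∧ G.pathRange (n + 1) μ = v} = ∅

/-- The positive orbit space `Orb⁺(v)` of a vertex. -/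
def orb (v : V) : Set V :=
  {w | ∃ (n : ℕ) (ν : G.PathN n), G.pathRange n ν = w ∧ G.pathSource n ν = v}

/-- `Orb⁺(r(μ)) ∪ ⋃ᵢ Orb⁺(s(μᵢ))` for a boundary path `μ`. -/
def cofinalSet (μ : G.BoundaryPath) : Set V :=
  G.orb (G.bRange μ) ∪ {w | ∃ (i : ℕ) (e : E), G.bEdge μ i = some e ∧ w ∈ G.orb (G.s e)}

/-- `E` is cofinal. -/
def Cofinal : Prop := ∀ μ : G.BoundaryPath, Dense (G.cofinalSet μ)

/-- Every open neighborhood `N` of `μ` in `E^{|μ|}` contains an open neighborhood `U` of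
`μ` with `r^{|μ|}(U) ⊆ s^{|μ|}(U)`. -/
def NbhdContracting (n : ℕ) (μ : G.PathN (n + 1)) : Prop :=
  ∀ N : Set (G.PathN (n + 1)), IsOpen N → μ ∈ N →
    ∃ U : Set (G.PathN (n + 1)), IsOpen U ∧ μ ∈ U ∧ U ⊆ N ∧
      G.pathRange (n + 1) '' U ⊆ G.pathSource (n + 1) '' U

/-- The set `B` of vertices which connect to a cycle `μ` with entrances such that every
open neighborhood of `μ` contains an open neighborhood `U` of `μ` with
`r^{|μ|}(U) ⊆ s^{|μ|}(U)`. -/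
def Bset : Set V :=
  {v | ∃ (n : ℕ) (μ : G.PathN (n + 1)), G.IsCycle n μ ∧ G.HasEntrances n μ ∧
    v ∈ G.orb (G.pathRange (n + 1) μ) ∧ G.NbhdContracting n μ}

/-- Truncation of a path of length `n + 1` to its first `m + 1` edges (`m ≤ n`). -/
def pathTrunc (m n : ℕ) (h : m ≤ n) (μ : G.PathN (n + 1)) : G.PathN (m + 1) :=
  ⟨fun i => μ.1 ⟨i.1, by omega⟩, fun i hi => μ.2 i (by omega)⟩

/-- The conditions on a finite family `{Uᵢ ⊆ E^{nᵢ+1}}` witnessing that `Vset` is a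
contracting open set in the sense of Katsura. -/
def ContractingWitness (Vset : Set V) (k : ℕ) (nf : Fin k → ℕ)
    (U : ∀ i : Fin k, Set (G.PathN (nf i + 1))) : Prop :=
  (∀ i, (U i).Nonempty ∧ IsOpen (U i)) ∧
  (∀ i, ∀ μ ∈ U i, G.pathRange (nf i + 1) μ ∈ Vset) ∧
  (∀ i j, i ≠ j → ∀ h : nf i ≤ nf j, ∀ μ ∈ U j, G.pathTrunc (nf i) (nf j) h μ ∉ U i) ∧
  closure Vset ⊂ ⋃ i, (G.pathSource (nf i + 1)) '' U i

/-- `Vset ⊆ E⁰` is a contracting open set in the sense of Katsura. -/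
def IsContractingSet (Vset : Set V) : Prop :=
  Vset.Nonempty ∧ IsOpen Vset ∧ IsCompact (closure Vset) ∧
    ∃ (k : ℕ) (nf : Fin k → ℕ) (U : ∀ i : Fin k, Set (G.PathN (nf i + 1))),
      G.ContractingWitness Vset k nf U

/-- `E` is contracting at the vertex `v`. -/
def ContractingAt (v : V) : Prop :=
  Dense (G.orb v) ∧ ∀ N : Set V, IsOpen N → v ∈ N →
    ∃ W : Set V, W ⊆ N ∧ G.IsContractingSet W

/-- `E` is a contracting topological graph. -/
def Contracting : Prop := ∃ v : V, G.ContractingAt v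

end TopGraph

namespace TopGraph

variable {V E : Type} [TopologicalSpace V] [TopologicalSpace E] (G : TopGraph V E)

/-- The initial segment of length `j` of a path of length `n` (`j ≤ n`). -/
def initSeg : (j n : ℕ) → j ≤ n → G.PathN n → G.PathN j
  | 0, n, _, β => G.pathRange n β
  | j + 1, n + 1, h, β => G.pathTrunc j n (Nat.le_of_succ_le_succ h) β

theorem pathRange_initSeg : ∀ (j n : ℕ) (h : j ≤ n) (β : G.PathN n),
    G.pathRange j (G.initSeg j n h β) = G.pathRange n β
  | 0, _, _, _ => rfl
  | _ + 1, _ + 1, _, _ => rfl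

theorem pathEdge_initSeg : ∀ (j n : ℕ) (h : j ≤ n) (β : G.PathN n) (i : ℕ), i < j →
    G.pathEdge j (G.initSeg j n h β) i = G.pathEdge n β i
  | 0, _, _, _, i, hi => absurd hi (Nat.not_lt_zero i)
  | j + 1, n + 1, h, β, i, hi => by
    have hin : i < n + 1 := hi.trans_le h
    simp only [pathEdge, hi, hin, dif_pos]
    rfl

theorem continuous_pathRange : ∀ n : ℕ, Continuous (G.pathRange n)
  | 0 => continuous_id
  | _ + 1 => G.cont_r.comp ((continuous_apply _).comp continuous_subtype_val)

theorem continuous_initSeg : ∀ (j n : ℕ) (h : j ≤ n), Continuous (G.initSeg j n h)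
  | 0, n, _ => G.continuous_pathRange n
  | j + 1, n + 1, h =>
    continuous_induced_rng.2 (continuous_pi fun i : Fin (j + 1) =>
      (continuous_apply (⟨i, i.2.trans_le h⟩ : Fin (n + 1))).comp continuous_subtype_val)

instance t2Space_pathN [T2Space V] [T2Space E] : (n : ℕ) → T2Space (G.PathN n)
  | 0 => inferInstanceAs (T2Space V)
  | n + 1 => inferInstanceAs (T2Space { μ : Fin (n + 1) → E // G.PathCond (n + 1) μ })

instance t2Space_finPath [T2Space V] [T2Space E] : T2Space G.FinPath :=
  inferInstanceAs (T2Space ((n : ℕ) × G.PathN n))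

/-- A path is determined by its length, its range and its edges. -/
theorem pathN_ext : ∀ (n : ℕ) (α β : G.PathN n), G.pathRange n α = G.pathRange n β →
    (∀ i < n, G.pathEdge n α i = G.pathEdge n β i) → α = β
  | 0, _, _, hr, _ => hr
  | n + 1, α, β, _, he => by
    refine Subtype.ext (funext fun i => ?_)
    simpa [pathEdge, i.2] using he i i.2

variable {G}

theorem IsPrefix.eq {n : ℕ} {α β : G.PathN n} {μ : G.BoundaryPath}
    (hα : G.IsPrefix ⟨n, α⟩ μ) (hβ : G.IsPrefix ⟨n, β⟩ μ) : α = β :=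
  G.pathN_ext n α β (hα.1.trans hβ.1.symm) fun i hi => (hα.2 i hi).symm.trans (hβ.2 i hi)

theorem IsPrefix.initSeg {j n : ℕ} (h : j ≤ n) {β : G.PathN n} {μ : G.BoundaryPath}
    (hβ : G.IsPrefix ⟨n, β⟩ μ) : G.IsPrefix ⟨j, G.initSeg j n h β⟩ μ :=
  ⟨(G.pathRange_initSeg j n h β).trans hβ.1, fun i hi =>
    (hβ.2 i (hi.trans_le h)).trans (G.pathEdge_initSeg j n h β i hi).symm⟩

theorem IsPrefix.length_le {α : G.FinPath} {μ : G.BoundaryPath} (h : G.IsPrefix α μ) :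
    (α.1 : ℕ∞) ≤ G.bLen μ := by
  rcases μ with μ | ⟨⟨m, β⟩, hβ⟩
  · exact le_top
  · obtain ⟨n, α⟩ := α
    refine Nat.cast_le.2 (not_lt.1 fun hlt => ?_)
    have he := h.2 m hlt
    change G.pathEdge m β m = G.pathEdge n α m at he
    change m < n at hlt
    cases n with
    | zero => exact absurd hlt (Nat.not_lt_zero m)
    | succ n => cases m <;> simp [pathEdge, hlt] at he

theorem exists_isPrefix {n : ℕ} {μ : G.BoundaryPath} (h : (n : ℕ∞) ≤ G.bLen μ) :
    ∃ β : G.PathN n, G.IsPrefix ⟨n, β⟩ μ := by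
  rcases μ with μ | ⟨⟨m, β⟩, hβ⟩
  · cases n with
    | zero => exact ⟨G.r (μ.1 0), rfl, fun i hi => absurd hi (Nat.not_lt_zero i)⟩
    | succ n =>
      refine ⟨⟨fun i => μ.1 i, fun i _ => μ.2 i⟩, rfl, fun i hi => ?_⟩
      change i < n + 1 at hi
      simp [bEdge, pathEdge, hi]
  · have hβ' : G.IsPrefix ⟨m, β⟩ (Sum.inr ⟨⟨m, β⟩, hβ⟩) := ⟨rfl, fun _ _ => rfl⟩
    exact ⟨_, hβ'.initSeg (Nat.cast_le.1 h)⟩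

end TopGraph

/-- Lemma 3.1, first part: for an open `U ⊆ E*` and compact `K ⊆ E*`
with `Z(U) ∩ Z(K)ᶜ ≠ ∅` and `K ⊆ ⋃_{i=0}^k Eⁱ`, every `μ ∈ Z(U) ∩ Z(K)ᶜ` with `|μ| ≥ k`
lies in some `Z(W) ⊆ Z(U) ∩ Z(K)ᶜ` with `W ⊆ E*` open. -/
theorem TopGraph.technical_lemma_one {V E : Type}
    [TopologicalSpace V] [TopologicalSpace E]
    [SecondCountableTopology V] [SecondCountableTopology E]
    [LocallyCompactSpace V] [LocallyCompactSpace E] [T2Space V] [T2Space E]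
    (G : TopGraph V E) (U K : Set G.FinPath) (hU : IsOpen U) (hK : IsCompact K)
    (k : ℕ) (hKk : ∀ α ∈ K, α.1 ≤ k)
    (hne : (G.cyl U ∩ (G.cyl K)ᶜ).Nonempty)
    (μ : G.BoundaryPath) (hμ : μ ∈ G.cyl U ∩ (G.cyl K)ᶜ)
    (hlen : (k : ℕ∞) ≤ G.bLen μ) :
    ∃ W : Set G.FinPath, IsOpen W ∧ μ ∈ G.cyl W ∧ G.cyl W ⊆ G.cyl U ∩ (G.cyl K)ᶜ := by
  obtain ⟨⟨⟨m, α⟩, hαU, hα⟩, hμK⟩ := hμ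
  have hmn : m ≤ max m k := le_max_left m k
  have hkn (j : Fin (k + 1)) : (j : ℕ) ≤ max m k :=
    (Nat.le_of_lt_succ j.2).trans (le_max_right m k)
  have hcont (j : ℕ) (h : j ≤ max m k) :
      Continuous fun β => (⟨j, G.initSeg j (max m k) h β⟩ : G.FinPath) :=
    continuous_sigmaMk.comp (G.continuous_initSeg j (max m k) h)
  have hle : ((max m k : ℕ) : ℕ∞) ≤ G.bLen μ := by
    rcases max_choice m k with h | h <;> rw [h]
    exacts [hα.length_le, hlen]
  obtain ⟨γ, hγ⟩ := exists_isPrefix hle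
  refine ⟨Sigma.mk (max m k) ''
    ({β | (⟨m, G.initSeg m (max m k) hmn β⟩ : G.FinPath) ∈ U} ∩
      ⋂ j : Fin (k + 1), {β | (⟨j, G.initSeg j (max m k) (hkn j) β⟩ : G.FinPath) ∈ Kᶜ}),
    isOpenMap_sigmaMk _ ((hU.preimage (hcont m hmn)).inter (isOpen_iInter_of_finite fun j =>
      hK.isClosed.isOpen_compl.preimage (hcont j (hkn j)))), ?_, ?_⟩
  · refine ⟨_, ⟨γ, ⟨?_, Set.mem_iInter.2 fun j hj => ?_⟩, rfl⟩, hγ⟩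
    · rwa [Set.mem_ofPred_eq, (hγ.initSeg hmn).eq hα]
    · exact hμK ⟨_, hj, hγ.initSeg (hkn j)⟩
  · rintro ν ⟨_, ⟨β, ⟨hβU, hβK⟩, rfl⟩, hβ⟩
    refine ⟨⟨_, hβU, hβ.initSeg hmn⟩, ?_⟩
    rintro ⟨⟨j, δ⟩, hδK, hδ⟩
    have hj : j < k + 1 := Nat.lt_succ_of_le (hKk _ hδK)
    refine Set.mem_iInter.1 hβK ⟨j, hj⟩ ?_
    rwa [← (hβ.initSeg (hkn ⟨j, hj⟩)).eq hδ] at hδK
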